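/- Let p be a prime and let n ≥ k ≥ 2. Let k' be the least integer with k' ≥ k such that there exists a power-of-p multiset of cardinality k' with sum n (such k' exists and satisfies k' ≤ n). Then the dimension over Z_p of the vector space of symmetric polynomials f ∈ Z_p[x_1,…,x_k], homogeneous of degree n, satisfying δ_2(f) = 0, equals the number of power-of-p multisets of cardinality k' with sum n (i.e., the number of ways to write n as a sum of k' powers of p, disregarding order). -/

import Mathlib

open MvPolynomial

/-- The `m`-coboundary map `δ_m` on polynomials in `k` variables `x_1, …, x_k`
(indexed by `Fin k`, with `j : Fin k` standing for the variable `x_{j+1}`),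
landing in polynomials in the variables `x_0, …, x_k` (indexed by `Fin (k+1)`). -/
noncomputable def delta (A : Type*) [CommRing A] (m k : ℕ)
    (f : MvPolynomial (Fin k) A) : MvPolynomial (Fin (k + 1)) A :=
  aeval (fun j : Fin k => (X j.succ : MvPolynomial (Fin (k + 1)) A)) f
    + ∑ i ∈ Finset.Icc 1 m, (-1 : MvPolynomial (Fin (k + 1)) A) ^ i *
        aeval (fun j : Fin k =>
          if (j : ℕ) + 1 < i then (X j.castSucc : MvPolynomial (Fin (k + 1)) A)
          else if (j : ℕ) + 1 = i then X j.castSucc + X j.succ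
          else X j.succ) f
    + (-1 : MvPolynomial (Fin (k + 1)) A) ^ (m + 1) *
        aeval (fun j : Fin k =>
          if (j : ℕ) + 1 ≤ m then (X j.castSucc : MvPolynomial (Fin (k + 1)) A)
          else X j.succ) f

/-- The monomial symmetric polynomial `τ λ` associated to a multi-index
`λ : Fin k → ℕ`: the sum of `x^μ` over the distinct rearrangements `μ` of `λ`. -/
noncomputable def tau (A : Type*) [CommRing A] {k : ℕ} (lam : Fin k → ℕ) :
    MvPolynomial (Fin k) A :=
  ∑ d ∈ (Finset.univ : Finset (Equiv.Perm (Fin k))).image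
      (fun σ => Finsupp.equivFunOnFinite.symm (fun i => lam (σ i))),
    monomial d (1 : A)

/-- The multiset of values of a multi-index `Fin k → ℕ`. -/
def multisetOf {k : ℕ} (lam : Fin k → ℕ) : Multiset ℕ :=
  Multiset.map lam Finset.univ.val

/-- The exponent multiset of an exponent vector `d : Fin k →₀ ℕ`. -/
def exMult {k : ℕ} (d : Fin k →₀ ℕ) : Multiset ℕ :=
  multisetOf (⇑d)

/-- `σ_p(n)`, the sum of the digits of `n` in base `p`. -/
def sigmaDigits (p n : ℕ) : ℕ := (Nat.digits p n).sum

/-- `α_p(λ)`, the number of carries when summing the entries of `λ` in base `p`;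
equivalently the `p`-adic valuation of the multinomial coefficient of `λ`. -/
def alphaCarry (p : ℕ) (s : Multiset ℕ) : ℕ :=
  padicValNat p (Nat.factorial s.sum / (s.map Nat.factorial).prod)

/-- The splitting distance `φ_p(λ) = (Σ_i σ_p(λ_i)) − |λ|`. -/
def phiSplit (p : ℕ) (s : Multiset ℕ) : ℕ :=
  (s.map (sigmaDigits p)).sum - Multiset.card s

/-- A multiset is power-of-`p` when all its entries are powers of `p`. -/
def IsPowOf (p : ℕ) (s : Multiset ℕ) : Prop := ∀ x ∈ s, ∃ a : ℕ, x = p ^ a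

/-- `λ` is `p`-carry-minimal: `α_p(λ) ≤ α_p(μ)` for every multiset `μ` of positive
integers with the same sum and the same number of entries as `λ`. -/
def IsCarryMin (p : ℕ) (s : Multiset ℕ) : Prop :=
  ∀ t : Multiset ℕ, (∀ x ∈ t, 0 < x) → t.sum = s.sum →
    Multiset.card t = Multiset.card s → alphaCarry p s ≤ alphaCarry p t

/-- A single gathering operation: replace two entries `a`, `b` by `a + b`. -/
def Gathers (s t : Multiset ℕ) : Prop :=
  ∃ a b u, s = a ::ₘ b ::ₘ u ∧ t = (a + b) ::ₘ u

/-- `gatherSet m λ = T^m(λ)`, the set of multisets obtained from `λ` by `m`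
successive gathering operations. -/
def gatherSet : ℕ → Multiset ℕ → Set (Multiset ℕ)
  | 0, s => {s}
  | m + 1, s => {t | ∃ u ∈ gatherSet m s, Gathers u t}

/-- One step of the annihilating-set construction: split an entry `x = a + b`
(with `a, b > 0` and no base-`p` carries in `a + b`), and add `b` onto another
entry `y`. -/
def AnnStep (p : ℕ) (μ ν : Multiset ℕ) : Prop :=
  ∃ (x y a b : ℕ) (u : Multiset ℕ), μ = x ::ₘ y ::ₘ u ∧ 0 < a ∧ 0 < b ∧ a + b = x ∧
    sigmaDigits p a + sigmaDigits p b = sigmaDigits p x ∧ ν = a ::ₘ (b + y) ::ₘ u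

/-- `ann_p(λ)`: the smallest set of multisets containing `λ` closed under `AnnStep`. -/
def annSet (p : ℕ) (lam : Multiset ℕ) : Set (Multiset ℕ) :=
  {μ | Relation.ReflTransGen (AnnStep p) lam μ}

/-- The `m`-coboundary map as a linear map. -/
noncomputable def deltaLM (A : Type*) [CommRing A] (m k : ℕ) :
    MvPolynomial (Fin k) A →ₗ[A] MvPolynomial (Fin (k + 1)) A :=
  (aeval (fun j : Fin k => (X j.succ : MvPolynomial (Fin (k + 1)) A))).toLinearMap
    + ∑ i ∈ Finset.Icc 1 m, ((-1 : A) ^ i) •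
        (aeval (fun j : Fin k =>
          if (j : ℕ) + 1 < i then (X j.castSucc : MvPolynomial (Fin (k + 1)) A)
          else if (j : ℕ) + 1 = i then X j.castSucc + X j.succ
          else X j.succ)).toLinearMap
    + ((-1 : A) ^ (m + 1)) •
        (aeval (fun j : Fin k =>
          if (j : ℕ) + 1 ≤ m then (X j.castSucc : MvPolynomial (Fin (k + 1)) A)
          else X j.succ)).toLinearMap

namespace S17

def Dl (p : ℕ) : List ℕ → Multiset ℕ
  | [] => 0
  | d :: L => Multiset.replicate d 1 + (Dl p L).map (fun x => p * x)

def DD (p m : ℕ) : Multiset ℕ := Dl p (Nat.digits p m)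

lemma Dl_card (p : ℕ) (L : List ℕ) : Multiset.card (Dl p L) = L.sum := by
  induction L with
  | nil => simp [Dl]
  | cons d L ih => simp [Dl, ih]

lemma sum_map_mulp (p : ℕ) (M : Multiset ℕ) : (M.map (fun x => p * x)).sum = p * M.sum := by
  induction M using Multiset.induction_on with
  | empty => simp
  | cons x M ih => simp [ih, mul_add]

lemma Dl_sum (p : ℕ) (L : List ℕ) : (Dl p L).sum = Nat.ofDigits p L := by
  induction L with
  | nil => simp [Dl]
  | cons d L ih => simp [Dl, Nat.ofDigits_cons, sum_map_mulp, ih]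

lemma Dl_pow (p : ℕ) (L : List ℕ) : IsPowOf p (Dl p L) := by
  induction L with
  | nil => simp [Dl, IsPowOf]
  | cons d L ih =>
    intro x hx
    simp only [Dl, Multiset.mem_add, Multiset.mem_map] at hx
    rcases hx with hx | ⟨y, hy, rfl⟩
    · exact ⟨0, by simpa using Multiset.eq_of_mem_replicate hx⟩
    · obtain ⟨a, rfl⟩ := ih y hy
      exact ⟨a + 1, by ring⟩

lemma DD_card (p m : ℕ) : Multiset.card (DD p m) = (Nat.digits p m).sum := Dl_card _ _
lemma DD_sum (p m : ℕ) : (DD p m).sum = m := by rw [DD, Dl_sum, Nat.ofDigits_digits]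
lemma DD_pow (p m : ℕ) : IsPowOf p (DD p m) := Dl_pow _ _

lemma pow_pos_mem {p : ℕ} (hp : p.Prime) {N : Multiset ℕ} (h : IsPowOf p N) {x : ℕ} (hx : x ∈ N) :
    0 < x := by
  obtain ⟨a, rfl⟩ := h x hx
  exact pow_pos hp.pos a

lemma ipadd {p : ℕ} {N M : Multiset ℕ} (h : IsPowOf p N) (h' : IsPowOf p M) :
    IsPowOf p (N + M) := by
  intro x hx
  rcases Multiset.mem_add.1 hx with hx | hx
  exacts [h x hx, h' x hx]

lemma ipmono {p : ℕ} {N M : Multiset ℕ} (h : IsPowOf p N) (h' : M ≤ N) :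
    IsPowOf p M := fun x hx => h x (Multiset.mem_of_le h' hx)

/-- combine `p` equal entries. -/
lemma combine {p : ℕ} (hp : p.Prime) {N : Multiset ℕ} (h : IsPowOf p N) {q : ℕ}
    (hq : p ≤ N.count q) : ∃ N', IsPowOf p N' ∧ N'.sum = N.sum ∧
      Multiset.card N' + (p - 1) = Multiset.card N := by
  have hle : Multiset.replicate p q ≤ N := Multiset.le_count_iff_replicate_le.1 hq
  obtain ⟨M, rfl⟩ := Multiset.le_iff_exists_add.1 hle
  have hp0 := hp.pos
  have hqm : q ∈ Multiset.replicate p q + M := by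
    simp [Multiset.mem_replicate, hp.ne_zero]
  obtain ⟨a, rfl⟩ := h q hqm
  refine ⟨p ^ (a + 1) ::ₘ M, ?_, ?_, ?_⟩
  · intro x hx
    rcases Multiset.mem_cons.1 hx with rfl | hx
    · exact ⟨_, rfl⟩
    · exact h x (Multiset.mem_add.2 (Or.inr hx))
  · simp [pow_succ]; ring
  · simp; omega

/-- reduced multisets are the digit multisets. -/
lemma reduced_eq {p : ℕ} (hp : p.Prime) (s : ℕ) : ∀ {N : Multiset ℕ}, IsPowOf p N →
    (∀ q, N.count q < p) → N.sum = s → N = DD p s := by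
  induction s using Nat.strong_induction_on with
  | _ s ih =>
  intro N h hr hs
  have hp0 := hp.pos
  have h1 := Multiset.filter_add_not (fun x => x = 1) N
  rw [Multiset.filter_eq'] at h1
  set R := N.filter (fun x => ¬ x = 1) with hR
  have hRd : ∀ x ∈ R, p ∣ x := by
    intro x hx
    obtain ⟨hx1, hx2⟩ := Multiset.mem_filter.1 hx
    obtain ⟨a, rfl⟩ := h x hx1
    cases a with
    | zero => simp at hx2
    | succ a => exact ⟨p ^ a, by ring⟩
  set N1 := R.map (fun x => x / p) with hN1
  have hRN : R = N1.map (fun x => p * x) := by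
    rw [hN1, Multiset.map_map]
    conv_lhs => rw [← Multiset.map_id R]
    apply Multiset.map_congr rfl
    intro x hx
    simp [Nat.mul_div_cancel' (hRd x hx)]
  have hN1p : IsPowOf p N1 := by
    intro y hy
    obtain ⟨x, hx, rfl⟩ := Multiset.mem_map.1 hy
    obtain ⟨hx1, hx2⟩ := Multiset.mem_filter.1 hx
    obtain ⟨a, rfl⟩ := h x hx1
    cases a with
    | zero => simp at hx2
    | succ a => exact ⟨a, by rw [pow_succ, Nat.mul_div_cancel _ hp0]⟩
  have hinj : Function.Injective (fun x => p * x) := fun x y hxy => Nat.eq_of_mul_eq_mul_left hp0 hxy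
  have hN1r : ∀ q, N1.count q < p := by
    intro q
    rw [← Multiset.count_map_eq_count' (fun x => p * x) N1 hinj q, ← hRN]
    exact lt_of_le_of_lt (Multiset.count_le_of_le _ (Multiset.filter_le _ _)) (hr _)
  have hsum : N.count 1 + p * N1.sum = s := by
    rw [← hs]
    conv_rhs => rw [← h1, hRN]
    simp [sum_map_mulp]
  by_cases h0 : N.count 1 = 0 ∧ N1.sum = 0
  · have hs0 : s = 0 := by rw [← hsum, h0.1, h0.2]; simp
    have : N = 0 := by
      rw [Multiset.eq_zero_iff_forall_notMem]
      intro x hx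
      have := pow_pos_mem hp h hx
      have := Multiset.le_sum_of_mem hx
      omega
    rw [this, hs0]; simp [DD, Dl]
  · have hlt : N1.sum < s := by
      rcases Nat.eq_zero_or_pos N1.sum with h2 | h2
      · have h3 : N.count 1 ≠ 0 := fun h => h0 ⟨h, h2⟩
        rw [h2] at hsum ⊢
        omega
      · have := hp.two_le
        nlinarith
    have e := ih _ hlt hN1p hN1r rfl
    have hd : Nat.digits p s = N.count 1 :: Nat.digits p N1.sum := by
      rw [← hsum]
      apply Nat.digits_add p hp.one_lt _ _ (hr 1)
      tauto
    rw [DD, hd, Dl]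
    change _ = _ + (DD p N1.sum).map _
    rw [← e, ← hRN, h1]

lemma card_min {p : ℕ} (hp : p.Prime) : ∀ (c : ℕ) {N : Multiset ℕ}, Multiset.card N = c →
    IsPowOf p N → (Nat.digits p N.sum).sum ≤ c ∧ ((Nat.digits p N.sum).sum = c → N = DD p N.sum) := by
  intro c
  induction c using Nat.strong_induction_on with
  | _ c ih =>
  intro N hc h
  by_cases hr : ∀ q, N.count q < p
  · have := reduced_eq hp _ h hr rfl
    refine ⟨?_, fun _ => this⟩
    rw [← DD_card, ← this, hc]
  · push Not at hr
    obtain ⟨q, hq⟩ := hr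
    obtain ⟨N', h1, h2, h3⟩ := combine hp h hq
    have := hp.two_le
    have := (ih (Multiset.card N') (by omega) rfl h1).1
    rw [h2] at this
    constructor
    · omega
    · intro; omega

lemma DD_red {p : ℕ} (hp : p.Prime) (m q : ℕ) : (DD p m).count q < p := by
  by_contra hq
  push Not at hq
  obtain ⟨N', h1, h2, h3⟩ := combine hp (DD_pow p m) hq
  have := (card_min hp _ rfl h1).1
  rw [h2, DD_sum, ← DD_card] at this
  have := hp.two_le
  omega

lemma DD_zero (p : ℕ) : DD p 0 = 0 := by simp [DD, Dl]

lemma DD_powp {p : ℕ} (hp : p.Prime) (a : ℕ) : DD p (p ^ a) = {p ^ a} := by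
  symm
  apply reduced_eq hp
  · intro x hx; exact ⟨a, by simpa using hx⟩
  · intro q
    have := Multiset.count_le_card q ({p ^ a} : Multiset ℕ)
    simp only [Multiset.card_singleton] at this
    have := hp.two_le
    omega
  · simp

lemma DD_card_pos {p : ℕ} {m : ℕ} (hm : 0 < m) : 0 < Multiset.card (DD p m) := by
  rw [Multiset.card_pos]
  intro h
  have := DD_sum p m
  rw [h] at this
  simp at this
  omega

lemma card_modEq {p : ℕ} (hp : p.Prime) {N : Multiset ℕ} (h : IsPowOf p N) :
    Multiset.card N ≡ N.sum [MOD (p - 1)] := by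
  induction N using Multiset.induction_on with
  | empty => simp; rfl
  | cons x N ih =>
    have := ih (ipmono h (Multiset.le_cons_self _ _))
    obtain ⟨a, rfl⟩ := h x (by simp)
    rw [Multiset.card_cons, Multiset.sum_cons, add_comm]
    apply Nat.ModEq.add _ this
    have h1 : 1 ≡ p [MOD (p - 1)] := (Nat.modEq_iff_dvd' hp.one_lt.le).2 dvd_rfl
    simpa using h1.pow a

/-- no carries -/
def nc (p a b : ℕ) : Prop := DD p (a + b) = DD p a + DD p b

lemma nc_iff {p : ℕ} (hp : p.Prime) (a b : ℕ) : nc p a b ↔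
    (Nat.digits p (a+b)).sum = (Nat.digits p a).sum + (Nat.digits p b).sum := by
  constructor
  · intro h
    have := congrArg Multiset.card h
    simpa [DD_card] using this
  · intro h
    have := (card_min hp _ (by rw [Multiset.card_add, DD_card, DD_card]) (ipadd (DD_pow p a) (DD_pow p b))).2
    simp only [Multiset.sum_add, DD_sum] at this
    exact (this h).symm

noncomputable def ww (p m : ℕ) : ZMod p := ((m.factorial / p ^ (m.factorial.factorization p) : ℕ) : ZMod p)

lemma ww_ne {p : ℕ} (hp : p.Prime) (m : ℕ) : ww p m ≠ 0 := by
  rw [ww, Ne, ZMod.natCast_eq_zero_iff]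
  exact Nat.not_dvd_ordCompl hp (Nat.factorial_ne_zero m)

open Classical in
lemma ww_choose {p : ℕ} (hp : p.Prime) (a b : ℕ) :
    (((a + b).choose a : ℕ) : ZMod p) * ww p a * ww p b = if nc p a b then ww p (a + b) else 0 := by
  have := Fact.mk hp
  have key := sub_one_mul_padicValNat_choose_eq_sub_sum_digits' (p := p) (k := a) (n := b)
  have hle := (card_min hp _ rfl (ipadd (DD_pow p a) (DD_pow p b))).1
  simp only [Multiset.sum_add, DD_sum, Multiset.card_add, DD_card] at hle
  rw [add_comm b a] at key
  have hp1 : 0 < p - 1 := by have := hp.two_le; omega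
  have hch : (a + b).choose a ≠ 0 := (Nat.choose_pos (by omega)).ne'
  split_ifs with h
  · rw [nc_iff hp] at h
    have hv : padicValNat p ((a + b).choose a) = 0 := by
      have : (p - 1) * padicValNat p ((a + b).choose a) = 0 := by omega
      rcases Nat.mul_eq_zero.1 this with h | h
      · omega
      · exact h
    have hf : ((a + b).choose a).factorization p = 0 := by
      rw [Nat.factorization_def _ hp, hv]
    have e := Nat.add_choose_mul_factorial_mul_factorial a b
    rw [← Nat.choose_symm_add] at e
    unfold ww
    rw [← e, Nat.ordCompl_mul, Nat.ordCompl_mul, hf]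
    push_cast
    simp
  · rw [nc_iff hp] at h
    have hv : p ∣ (a + b).choose a := by
      by_contra hd
      rw [padicValNat.eq_zero_of_not_dvd hd] at key
      omega
    rw [(ZMod.natCast_eq_zero_iff _ _).2 hv]; simp

lemma DD_of_pow {p : ℕ} (hp : p.Prime) {q : ℕ} (h : ∃ a, q = p ^ a) : DD p q = {q} := by
  obtain ⟨a, rfl⟩ := h
  exact DD_powp hp a

lemma DD_self_of_card {p m : ℕ} (h : Multiset.card (DD p m) = 1) : DD p m = {m} := by
  obtain ⟨x, hx⟩ := Multiset.card_eq_one.1 h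
  have := DD_sum p m
  rw [hx] at this
  simp at this
  rw [hx, this]

lemma DD_erase {p : ℕ} (hp : p.Prime) {m q : ℕ} (h : q ∈ DD p m) :
    q ≤ m ∧ DD p (m - q) = (DD p m).erase q := by
  have h1 := Multiset.sum_erase h
  rw [DD_sum] at h1
  refine ⟨by omega, ?_⟩
  symm
  apply reduced_eq hp
  · exact ipmono (DD_pow p m) (Multiset.erase_le _ _)
  · intro x
    exact lt_of_le_of_lt (Multiset.count_le_of_le _ (Multiset.erase_le _ _)) (DD_red hp m x)
  · omega

def Db (p : ℕ) (s : Multiset ℕ) : Multiset ℕ := (s.map (DD p)).sum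

lemma Db_zero (p : ℕ) : Db p 0 = 0 := by simp [Db]
lemma Db_cons (p x : ℕ) (s : Multiset ℕ) : Db p (x ::ₘ s) = DD p x + Db p s := by simp [Db]

lemma Db_of_pow {p : ℕ} (hp : p.Prime) {Q : Multiset ℕ} (h : IsPowOf p Q) : Db p Q = Q := by
  induction Q using Multiset.induction_on with
  | empty => simp [Db]
  | cons x Q ih =>
    rw [Db_cons, ih (ipmono h (Multiset.le_cons_self _ _)), DD_of_pow hp (h x (by simp))]
    simp

lemma Db_sum (p : ℕ) (s : Multiset ℕ) : (Db p s).sum = s.sum := by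
  induction s using Multiset.induction_on with
  | empty => simp [Db]
  | cons x Q ih => rw [Db_cons]; simp [ih, DD_sum]

lemma Db_pow (p : ℕ) (s : Multiset ℕ) : IsPowOf p (Db p s) := by
  induction s using Multiset.induction_on with
  | empty => simp [Db, IsPowOf]
  | cons x Q ih => rw [Db_cons]; exact ipadd (DD_pow p x) ih

lemma Db_card (p : ℕ) {s : Multiset ℕ} (h : ∀ x ∈ s, 0 < x) :
    Multiset.card s ≤ Multiset.card (Db p s) := by
  induction s using Multiset.induction_on with
  | empty => simp [Db]
  | cons x Q ih =>
    rw [Db_cons]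
    have := ih (fun y hy => h y (by simp [hy]))
    have := DD_card_pos (p := p) (h x (by simp))
    simp; omega

/-- minimality of `k'`. -/
def MinK (p n k k' : ℕ) : Prop := ∀ j : ℕ, k ≤ j →
        (∃ μ : Multiset ℕ, IsPowOf p μ ∧ Multiset.card μ = j ∧ μ.sum = n) → k' ≤ j

lemma good_red {p n K k' : ℕ} (hp : p.Prime) (hmin : MinK p n (K + 2) k') {M R : Multiset ℕ}
    (h : IsPowOf p (M + R)) (hc : Multiset.card (M + R) = k') (hs : (M + R).sum = n)
    (hR : K + 1 ≤ Multiset.card R) : M = DD p M.sum := by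
  apply reduced_eq hp _ (ipmono h (Multiset.le_add_right _ _)) _ rfl
  intro q
  by_contra hq
  push Not at hq
  have h1 : p ≤ (M + R).count q := by rw [Multiset.count_add]; omega
  obtain ⟨N', h2, h3, h4⟩ := combine hp h h1
  have h5 := Multiset.count_le_card q M
  have h7 := hp.two_le
  rw [Multiset.card_add] at hc h4
  have h6 := hmin (Multiset.card N') (by omega) ⟨N', h2, rfl, by rw [h3, hs]⟩
  omega

open Classical in
def Rel (p K : ℕ) (C : Multiset ℕ → ZMod p) : Prop :=
  ∀ a b c u, 0 < a → 0 < b → 0 < c → (∀ x ∈ u, 0 < x) → Multiset.card u = K →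
    (if nc p a b then C ((a + b) ::ₘ c ::ₘ u) else 0) =
      (if nc p b c then C (a ::ₘ (b + c) ::ₘ u) else 0)

open Classical in
lemma transfer {p K : ℕ} (hp : p.Prime) {C : Multiset ℕ → ZMod p} (hC : Rel p K C)
    {m q r : ℕ} {u : Multiset ℕ} (hq : q ∈ DD p m) (hqm : q ≠ m) (hr : 0 < r)
    (hu : ∀ x ∈ u, 0 < x) (hK : Multiset.card u = K) :
    C (m ::ₘ r ::ₘ u) = if nc p (m - q) r then C (q ::ₘ (m - q + r) ::ₘ u) else 0 := by
  obtain ⟨h1, h2⟩ := DD_erase hp hq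
  have hq0 := pow_pos_mem hp (DD_pow p m) hq
  have := hC q (m - q) r u hq0 (by omega) hr hu hK
  rw [if_pos] at this
  · rw [← this, Nat.add_sub_cancel' h1]
  · rw [nc, Nat.add_sub_cancel' h1, h2, DD_of_pow hp (DD_pow p m q hq), Multiset.singleton_add,
      Multiset.cons_erase hq]

lemma claimA {p K : ℕ} (hp : p.Prime) {C : Multiset ℕ → ZMod p} (hC : Rel p K C)
    (u : Multiset ℕ) : ∀ (P : Multiset ℕ) (x : ℕ), 0 < x → (∀ y ∈ u, 0 < y) → IsPowOf p P →
    Multiset.card P + Multiset.card u = K + 1 →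
    C (x ::ₘ (P + u)) = 0 ∨ ∃ m Q, 0 < m ∧ IsPowOf p Q ∧ Multiset.card Q = K + 1 ∧
      DD p m + Q = DD p x + (P + Db p u) ∧ C (x ::ₘ (P + u)) = C (m ::ₘ Q) := by
  induction u using Multiset.induction_on with
  | empty =>
    intro P x hx hu hP hc
    right
    refine ⟨x, P, hx, hP, by simpa using hc, by simp [Db_zero], by simp⟩
  | cons y u ih =>
    intro P x hx hu hP hc
    have hy : 0 < y := hu y (by simp)
    have hu' : ∀ z ∈ u, 0 < z := fun z hz => hu z (by simp [hz])
    rw [Multiset.card_cons] at hc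
    obtain ⟨q, hq⟩ := Multiset.card_pos_iff_exists_mem.1 (DD_card_pos (p := p) hy)
    have hqp := DD_pow p y q hq
    have hqP : IsPowOf p (q ::ₘ P) := by
      intro z hz
      rcases Multiset.mem_cons.1 hz with rfl | hz
      exacts [hqp, hP z hz]
    by_cases hqy : q = y
    · subst hqy
      have e : P + q ::ₘ u = (q ::ₘ P) + u := by simp
      have := ih (q ::ₘ P) x hx hu' hqP (by simp; omega)
      rw [e, Db_cons, DD_of_pow hp hqp]
      have e2 : P + ({q} + Db p u) = (q ::ₘ P) + Db p u := by
        rw [← Multiset.singleton_add]; abel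
      rw [e2]; exact this
    · have ht := transfer hp hC (r := x) (u := P + u) hq hqy hx (by
        intro z hz
        rcases Multiset.mem_add.1 hz with hz | hz
        exacts [pow_pos_mem hp hP hz, hu' z hz]) (by simp; omega)
      have e : x ::ₘ (P + y ::ₘ u) = y ::ₘ x ::ₘ (P + u) := by
        rw [Multiset.cons_swap, Multiset.add_cons]
      rw [e, ht]
      split_ifs with hnc
      · have := ih (q ::ₘ P) (y - q + x) (by omega) hu' hqP (by simp; omega)
        have e3 : q ::ₘ (y - q + x) ::ₘ (P + u) = (y - q + x) ::ₘ (q ::ₘ P + u) := by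
          rw [Multiset.cons_swap, Multiset.cons_add]
        rw [e3]
        have e4 : DD p (y - q + x) + (q ::ₘ P + Db p u) = DD p x + (P + Db p (y ::ₘ u)) := by
          rw [hnc, (DD_erase hp hq).2, Db_cons]
          conv_rhs => rw [← Multiset.cons_erase hq]
          rw [← Multiset.singleton_add, ← Multiset.singleton_add q (Multiset.erase _ _)]
          abel
        rw [← e4]
        exact this
      · left; rfl

lemma bad {p K : ℕ} (hp : p.Prime) {C : Multiset ℕ → ZMod p} (hC : Rel p K C) (q : ℕ) (t : ℕ) :
    ∀ (m : ℕ) (Q : Multiset ℕ), IsPowOf p Q → Multiset.card Q = K + 1 →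
      p ≤ (DD p m + Q).count q → p ≤ Multiset.card (DD p m) → p ≤ t + (DD p m).count q →
      C (m ::ₘ Q) = 0 := by
  induction t with
  | zero =>
    intro m Q _ _ _ _ h
    have := DD_red hp m q
    omega
  | succ t ih =>
    intro m Q hQ hK h1 h2 h3
    have hr := DD_red hp m q
    have h2p := hp.two_le
    rw [Multiset.count_add] at h1
    have hqQ : q ∈ Q := Multiset.count_pos.1 (by omega)
    obtain ⟨Q', rfl⟩ := Multiset.exists_cons_of_mem hqQ
    rw [Multiset.card_cons] at hK
    have : ∃ s ∈ DD p m, s ≠ q := by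
      by_contra hcon
      push Not at hcon
      have := Multiset.count_eq_card.2 (fun x hx => (hcon x hx).symm)
      omega
    obtain ⟨s, hs, hsq⟩ := this
    have hsp := DD_pow p m s hs
    have hsm : s ≠ m := by
      rintro rfl
      rw [DD_of_pow hp hsp] at h2
      simp at h2
      omega
    rw [transfer hp hC hs hsm (pow_pos_mem hp hQ hqQ)
      (fun x hx => pow_pos_mem hp hQ (Multiset.mem_cons_of_mem hx)) (by omega)]
    split_ifs with hnc
    · rw [Multiset.cons_swap]
      have hcnt := Multiset.count_erase_of_ne hsq.symm (DD p m)
      have hcard := Multiset.card_erase_add_one hs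
      have hD : DD p (m - s + q) = (DD p m).erase s + {q} := by
        rw [hnc, (DD_erase hp hs).2, DD_of_pow hp (hQ q hqQ)]
      apply ih
      · intro z hz
        rcases Multiset.mem_cons.1 hz with rfl | hz
        exacts [hsp, hQ z (Multiset.mem_cons_of_mem hz)]
      · simp; omega
      · rw [hD]
        simp only [Multiset.count_add, hcnt, Multiset.count_cons_of_ne hsq.symm,
          Multiset.count_singleton_self]
        rw [Multiset.count_cons_self] at h1
        omega
      · rw [hD]; simp; omega
      · rw [hD]; simp only [Multiset.count_add, hcnt, Multiset.count_singleton_self]; omega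
    · rfl

lemma good {p n K k' : ℕ} (hp : p.Prime) (hmin : MinK p n (K + 2) k')
    {C : Multiset ℕ → ZMod p} (hC : Rel p K C) (m' : ℕ) (Q' : Multiset ℕ)
    (hQ' : Multiset.card Q' = K + 1) (t : ℕ) :
    ∀ (m : ℕ) (Q : Multiset ℕ), IsPowOf p Q → Multiset.card Q = K + 1 →
      DD p m + Q = DD p m' + Q' → Multiset.card (DD p m + Q) = k' → (DD p m + Q).sum = n →
      Multiset.card (Q - Q') = t → C (m ::ₘ Q) = C (m' ::ₘ Q') := by
  induction t using Nat.strong_induction_on with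
  | _ t ih =>
  intro m Q hQ hK hN hk hn ht
  have hcc := congrArg Multiset.card hN
  rw [Multiset.card_add, Multiset.card_add] at hcc
  by_cases h1 : Multiset.card (DD p m) = 1
  · have e1 := DD_self_of_card h1
    have e2 := DD_self_of_card (p := p) (m := m') (by omega)
    rw [e1, e2, Multiset.singleton_add, Multiset.singleton_add] at hN
    rw [hN]
  by_cases hQQ : Q = Q'
  · subst hQQ
    have := congrArg Multiset.sum (add_right_cancel hN)
    rw [DD_sum, DD_sum] at this
    rw [this]
  have hne1 : Q - Q' ≠ 0 := by
    intro h
    exact hQQ (Multiset.eq_of_le_of_card_le (tsub_eq_zero_iff_le.1 h) (by omega))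
  have hne2 : Q' - Q ≠ 0 := by
    intro h
    exact hQQ (Multiset.eq_of_le_of_card_le (tsub_eq_zero_iff_le.1 h) (by omega)).symm
  obtain ⟨r, hr⟩ := Multiset.exists_mem_of_ne_zero hne1
  obtain ⟨q, hq⟩ := Multiset.exists_mem_of_ne_zero hne2
  have hr' := Multiset.count_pos.2 hr
  have hq' := Multiset.count_pos.2 hq
  rw [Multiset.count_sub] at hr' hq'
  have hqr : q ≠ r := by rintro rfl; omega
  have hcq := congrArg (Multiset.count q) hN
  rw [Multiset.count_add, Multiset.count_add] at hcq
  have hqm : q ∈ DD p m := Multiset.count_pos.1 (by omega)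
  have hqp := DD_pow p m q hqm
  have hrQ : r ∈ Q := Multiset.count_pos.1 (by omega)
  have hqne : q ≠ m := by
    rintro rfl
    rw [DD_of_pow hp hqp] at h1
    simp at h1
  obtain ⟨Q1, rfl⟩ := Multiset.exists_cons_of_mem hrQ
  have hrp := hQ r hrQ
  rw [Multiset.card_cons] at hK
  obtain ⟨hqle, hDe⟩ := DD_erase hp hqm
  have hQ1p : IsPowOf p (q ::ₘ Q1) := by
    intro z hz
    rcases Multiset.mem_cons.1 hz with rfl | hz
    exacts [hqp, hQ z (Multiset.mem_cons_of_mem hz)]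
  have hNN : ((DD p m).erase q + {r}) + q ::ₘ Q1 = DD p m + r ::ₘ Q1 := by
    conv_rhs => rw [← Multiset.cons_erase hqm]
    rw [← Multiset.singleton_add, ← Multiset.singleton_add q (Multiset.erase _ _),
      ← Multiset.singleton_add r Q1]
    abel
  have hD : (DD p m).erase q + {r} = DD p (m - q + r) := by
    have := good_red hp hmin (M := (DD p m).erase q + {r}) (R := q ::ₘ Q1)
      (by rw [hNN]; exact ipadd (DD_pow p m) hQ) (by rw [hNN]; exact hk) (by rw [hNN]; exact hn)
      (by simp; omega)
    rw [this]
    congr 1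
    rw [← hDe, Multiset.sum_add, DD_sum, Multiset.sum_singleton]
  have hnc : nc p (m - q) r := by
    rw [nc, ← hD, hDe, DD_of_pow hp hrp]
  rw [transfer hp hC hqm hqne (pow_pos_mem hp hQ hrQ)
      (fun x hx => pow_pos_mem hp hQ (Multiset.mem_cons_of_mem hx)) (by omega), if_pos hnc,
      Multiset.cons_swap]
  have hsub : q ::ₘ Q1 - Q' = (r ::ₘ Q1 - Q').erase r := by
    ext x
    rw [Multiset.count_sub]
    by_cases hxr : x = r
    · subst hxr
      rw [Multiset.count_erase_self, Multiset.count_sub, Multiset.count_cons_self,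
        Multiset.count_cons_of_ne hqr.symm]
      omega
    · rw [Multiset.count_erase_of_ne hxr, Multiset.count_sub, Multiset.count_cons_of_ne hxr]
      by_cases hxq : x = q
      · subst hxq
        rw [Multiset.count_cons_self]
        rw [Multiset.count_cons_of_ne hxr] at hq'
        omega
      · rw [Multiset.count_cons_of_ne hxq]
  have hlt := Multiset.card_erase_lt_of_mem hr
  rw [← hsub] at hlt
  exact ih _ (by omega) _ _ hQ1p (by simp; omega) (by rw [← hD, hNN, hN])
    (by rw [← hD, hNN]; exact hk) (by rw [← hD, hNN]; exact hn) rfl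

/-- existence of representatives -/
lemma exists_rep {p n K k' : ℕ} (hp : p.Prime) (hmin : MinK p n (K + 2) k') (hkk : K + 2 ≤ k')
    {N : Multiset ℕ} (h : IsPowOf p N) (hc : Multiset.card N = k') (hs : N.sum = n) :
    ∃ m Q, 0 < m ∧ IsPowOf p Q ∧ Multiset.card Q = K + 1 ∧ DD p m + Q = N := by
  have : ∃ Q ≤ N, Multiset.card Q = K + 1 := by
    refine ⟨((N.toList.take (K + 1) : List ℕ) : Multiset ℕ), ?_, ?_⟩
    · conv_rhs => rw [← Multiset.coe_toList N]
      exact (List.take_sublist _ _).subperm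
    · simp; omega
  obtain ⟨Q, hQ, hQc⟩ := this
  obtain ⟨M, rfl⟩ := Multiset.le_iff_exists_add.1 hQ
  rw [add_comm] at h hc hs
  have := good_red hp hmin h hc hs (by omega)
  refine ⟨M.sum, Q, ?_, ipmono h (Multiset.le_add_left _ _), hQc, by rw [← this, add_comm]⟩
  rw [Multiset.card_add] at hc
  rcases Nat.eq_zero_or_pos M.sum with h0 | h0
  · rw [h0, DD_zero] at this
    rw [this] at hc
    simp at hc; omega
  · exact h0

/-- uniqueness: a relation function vanishing on representatives vanishes. -/
lemma vanish {p n K k' : ℕ} (hp : p.Prime) (hmin : MinK p n (K + 2) k') 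
    (hex : ∃ μ : Multiset ℕ, IsPowOf p μ ∧ Multiset.card μ = k' ∧ μ.sum = n) (hkk : K + 2 ≤ k')
    {C : Multiset ℕ → ZMod p} (hC : Rel p K C)
    (h0 : ∀ N, IsPowOf p N → Multiset.card N = k' → N.sum = n → ∃ m Q, IsPowOf p Q ∧
      Multiset.card Q = K + 1 ∧ DD p m + Q = N ∧ C (m ::ₘ Q) = 0)
    (s : Multiset ℕ) (hs : ∀ x ∈ s, 0 < x) (hc : Multiset.card s = K + 2) (hn : s.sum = n) :
    C s = 0 := by
  have : ∃ x, x ∈ s := Multiset.card_pos_iff_exists_mem.1 (by omega)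
  obtain ⟨x, hx⟩ := this
  obtain ⟨u, rfl⟩ := Multiset.exists_cons_of_mem hx
  rw [Multiset.card_cons] at hc
  rcases claimA hp hC u 0 x (hs x hx) (fun y hy => hs y (Multiset.mem_cons_of_mem hy))
    (by simp [IsPowOf]) (by simp; omega) with h | ⟨m, Q, hm, hQ, hQc, hD, he⟩
  · simpa using h
  rw [zero_add] at he hD
  rw [he]
  have hNp : IsPowOf p (DD p m + Q) := ipadd (DD_pow p m) hQ
  have hNs : (DD p m + Q).sum = n := by
    rw [hD, ← Db_cons, Db_sum, hn]
  by_cases hk : Multiset.card (DD p m + Q) = k'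
  · obtain ⟨m', Q', hQ', hQ'c, hD', hz⟩ := h0 _ hNp hk hNs
    rw [good hp hmin hC m' Q' hQ'c _ m Q hQ hQc hD'.symm hk hNs rfl, hz]
  · have hmp := DD_card_pos (p := p) hm
    have hle := hmin (Multiset.card (DD p m + Q)) (by rw [Multiset.card_add]; omega)
      ⟨_, hNp, rfl, hNs⟩
    obtain ⟨μ, hμ, hμc, hμs⟩ := hex
    have hmod : k' ≡ Multiset.card (DD p m + Q) [MOD (p - 1)] := by
      have h1 := card_modEq hp hμ
      have h2 := card_modEq hp hNp
      rw [hμc, hμs] at h1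
      rw [hNs] at h2
      exact h1.trans h2.symm
    have hdvd := (Nat.modEq_iff_dvd' hle).1 hmod
    have hge := Nat.le_of_dvd (by omega) hdvd
    have hp2 := hp.two_le
    have : ∃ q, p ≤ (DD p m + Q).count q := by
      by_contra hcon
      push Not at hcon
      have e := reduced_eq hp _ hNp hcon hNs
      have h3 := (card_min hp _ rfl hμ).1
      rw [hμs, ← DD_card, ← e] at h3
      omega
    obtain ⟨q, hq⟩ := this
    rw [Multiset.card_add] at hge hk hle
    exact bad hp hC q p m Q hQ hQc hq (by omega) (by omega)

noncomputable def fs {m : ℕ} (v : Fin m → ℕ) : Fin m →₀ ℕ := Finsupp.equivFunOnFinite.symm v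

lemma fs_surj {m : ℕ} (d : Fin m →₀ ℕ) : ∃ v, d = fs v :=
  ⟨d, by simp [fs]⟩

lemma fs_inj {m : ℕ} {v w : Fin m → ℕ} : fs v = fs w ↔ v = w := by simp [fs]

noncomputable def f2 {K : ℕ} (a b : ℕ) (v : Fin K → ℕ) : Fin (K + 2) →₀ ℕ :=
  fs (Fin.cons a (Fin.cons b v))
noncomputable def f3 {K : ℕ} (a b c : ℕ) (v : Fin K → ℕ) : Fin (K + 3) →₀ ℕ :=
  fs (Fin.cons a (Fin.cons b (Fin.cons c v)))

lemma f2_surj {K : ℕ} (d : Fin (K + 2) →₀ ℕ) : ∃ a b v, d = f2 a b v := by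
  obtain ⟨v, rfl⟩ := fs_surj d
  exact ⟨v 0, v 1, fun i => v i.succ.succ, by
    unfold f2
    congr 1
    funext i
    refine Fin.cases rfl (fun i => Fin.cases rfl (fun i => rfl) i) i⟩

lemma f3_surj {K : ℕ} (d : Fin (K + 3) →₀ ℕ) : ∃ a b c v, d = f3 a b c v := by
  obtain ⟨v, rfl⟩ := fs_surj d
  exact ⟨v 0, v 1, v 2, fun i => v i.succ.succ.succ, by
    unfold f3
    congr 1
    funext i
    refine Fin.cases rfl (fun i => Fin.cases rfl (fun i => Fin.cases rfl (fun i => rfl) i) i) i⟩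

lemma f2_inj {K : ℕ} {a b a' b' : ℕ} {v v' : Fin K → ℕ} :
    f2 a b v = f2 a' b' v' ↔ a = a' ∧ b = b' ∧ v = v' := by
  rw [f2, f2, fs_inj, Fin.cons_inj, Fin.cons_inj]

lemma f3_inj {K : ℕ} {a b c a' b' c' : ℕ} {v v' : Fin K → ℕ} :
    f3 a b c v = f3 a' b' c' v' ↔ a = a' ∧ b = b' ∧ c = c' ∧ v = v' := by
  rw [f3, f3, fs_inj, Fin.cons_inj, Fin.cons_inj, Fin.cons_inj]

section
variable {A : Type*} [CommRing A] {K : ℕ}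

lemma mon3 (a b c : ℕ) (v : Fin K → ℕ) :
    (X 0 ^ a * (X 1 ^ b * (X 2 ^ c * ∏ j : Fin K, X j.succ.succ.succ ^ v j)) : MvPolynomial (Fin (K + 3)) A)
      = monomial (f3 a b c v) 1 := by
  rw [monomial_eq, Finsupp.prod_fintype _ _ (by simp), Fin.prod_univ_succ, Fin.prod_univ_succ,
    Fin.prod_univ_succ]
  simp [f3, fs]
  rfl

lemma aev2 (g : Fin (K + 2) → MvPolynomial (Fin (K + 3)) A) (x y : ℕ) (w : Fin K → ℕ) (r : A) :
    aeval g (monomial (f2 x y w) r) = C r * (g 0 ^ x * (g 1 ^ y * ∏ j : Fin K, g j.succ.succ ^ w j)) := by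
  rw [aeval_monomial, Finsupp.prod_fintype _ _ (by simp), Fin.prod_univ_succ, Fin.prod_univ_succ]
  simp [f2, fs, algebraMap_eq]

lemma cT0 (g : Fin (K + 2) → MvPolynomial (Fin (K + 3)) A) (h0 : g 0 = X 1) (h1 : g 1 = X 2)
    (h2 : ∀ j : Fin K, g j.succ.succ = X j.succ.succ.succ) (f : MvPolynomial (Fin (K + 2)) A)
    (a b c : ℕ) (v : Fin K → ℕ) :
    coeff (f3 a b c v) (aeval g f) = if a = 0 then coeff (f2 b c v) f else 0 := by
  induction f using MvPolynomial.induction_on' with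
  | add p q hp hq => rw [map_add, coeff_add, hp, hq]; split_ifs <;> simp
  | monomial d r =>
    obtain ⟨x, y, w, rfl⟩ := f2_surj d
    have := mon3 (A := A) 0 x y w
    rw [pow_zero, one_mul] at this
    rw [aev2, h0, h1]
    simp only [h2]
    rw [this, coeff_C_mul, coeff_monomial, coeff_monomial]
    simp only [f2_inj, f3_inj]
    by_cases ha : a = 0
    · subst ha; simp
    · simp [ha, Ne.symm ha]

lemma cT3 (g : Fin (K + 2) → MvPolynomial (Fin (K + 3)) A) (h0 : g 0 = X 0) (h1 : g 1 = X 1)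
    (h2 : ∀ j : Fin K, g j.succ.succ = X j.succ.succ.succ) (f : MvPolynomial (Fin (K + 2)) A)
    (a b c : ℕ) (v : Fin K → ℕ) :
    coeff (f3 a b c v) (aeval g f) = if c = 0 then coeff (f2 a b v) f else 0 := by
  induction f using MvPolynomial.induction_on' with
  | add p q hp hq => rw [map_add, coeff_add, hp, hq]; split_ifs <;> simp
  | monomial d r =>
    obtain ⟨x, y, w, rfl⟩ := f2_surj d
    have := mon3 (A := A) x y 0 w
    rw [pow_zero, one_mul] at this
    rw [aev2, h0, h1]
    simp only [h2]
    rw [this, coeff_C_mul, coeff_monomial, coeff_monomial]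
    simp only [f2_inj, f3_inj]
    by_cases ha : c = 0
    · subst ha; simp
    · simp [ha, Ne.symm ha]

lemma cT1 (g : Fin (K + 2) → MvPolynomial (Fin (K + 3)) A) (h0 : g 0 = X 0 + X 1) (h1 : g 1 = X 2)
    (h2 : ∀ j : Fin K, g j.succ.succ = X j.succ.succ.succ) (f : MvPolynomial (Fin (K + 2)) A)
    (a b c : ℕ) (v : Fin K → ℕ) :
    coeff (f3 a b c v) (aeval g f) = ((a + b).choose a : A) * coeff (f2 (a + b) c v) f := by
  induction f using MvPolynomial.induction_on' with
  | add p q hp hq => rw [map_add, coeff_add, hp, hq, coeff_add]; ring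
  | monomial d r =>
    obtain ⟨x, y, w, rfl⟩ := f2_surj d
    have : (g 0 ^ x * (g 1 ^ y * ∏ j : Fin K, g j.succ.succ ^ w j)) =
      ∑ i ∈ Finset.range (x + 1), C ((x.choose i : ℕ) : A) * monomial (f3 i (x - i) y w) 1 := by
      rw [h0, h1, add_pow, Finset.sum_mul]
      simp only [h2]
      apply Finset.sum_congr rfl
      intro i _
      rw [← mon3, map_natCast]
      ring
    rw [aev2, this, coeff_C_mul, coeff_sum, coeff_monomial]
    simp only [coeff_C_mul, coeff_monomial, f2_inj, f3_inj]
    by_cases hx : x = a + b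
    · subst hx
      rw [Finset.sum_eq_single a]
      · simp [mul_comm]
      · intro i _ hi; simp [hi]
      · intro h; simp at h
    · rw [if_neg (by tauto), Finset.sum_eq_zero]
      · simp
      · intro i hi
        rw [if_neg, mul_zero]
        rw [Finset.mem_range] at hi
        omega

lemma cT2 (g : Fin (K + 2) → MvPolynomial (Fin (K + 3)) A) (h0 : g 0 = X 0) (h1 : g 1 = X 1 + X 2)
    (h2 : ∀ j : Fin K, g j.succ.succ = X j.succ.succ.succ) (f : MvPolynomial (Fin (K + 2)) A)
    (a b c : ℕ) (v : Fin K → ℕ) :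
    coeff (f3 a b c v) (aeval g f) = ((b + c).choose b : A) * coeff (f2 a (b + c) v) f := by
  induction f using MvPolynomial.induction_on' with
  | add p q hp hq => rw [map_add, coeff_add, hp, hq, coeff_add]; ring
  | monomial d r =>
    obtain ⟨y, x, w, rfl⟩ := f2_surj d
    have : (g 0 ^ y * (g 1 ^ x * ∏ j : Fin K, g j.succ.succ ^ w j)) =
      ∑ i ∈ Finset.range (x + 1), C ((x.choose i : ℕ) : A) * monomial (f3 y i (x - i) w) 1 := by
      rw [h0, h1, add_pow, Finset.sum_mul, Finset.mul_sum]
      simp only [h2]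
      apply Finset.sum_congr rfl
      intro i _
      rw [← mon3, map_natCast]
      ring
    rw [aev2, this, coeff_C_mul, coeff_sum, coeff_monomial]
    simp only [coeff_C_mul, coeff_monomial, f2_inj, f3_inj]
    by_cases hx : x = b + c
    · subst hx
      rw [Finset.sum_eq_single b]
      · simp [mul_comm]
      · intro i _ hi; simp [hi]
      · intro h; simp at h
    · rw [if_neg (by tauto), Finset.sum_eq_zero]
      · simp
      · intro i hi
        rw [if_neg, mul_zero]
        rw [Finset.mem_range] at hi
        omega

lemma coeff_delta (f : MvPolynomial (Fin (K + 2)) A) (a b c : ℕ) (v : Fin K → ℕ) :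
    coeff (f3 a b c v) (deltaLM A 2 (K + 2) f) =
      (if a = 0 then coeff (f2 b c v) f else 0)
      - ((a + b).choose a : A) * coeff (f2 (a + b) c v) f
      + ((b + c).choose b : A) * coeff (f2 a (b + c) v) f
      - (if c = 0 then coeff (f2 a b v) f else 0) := by
  have hI : Finset.Icc 1 2 = ({1, 2} : Finset ℕ) := by decide
  unfold deltaLM
  rw [hI, Finset.sum_pair (by norm_num)]
  simp only [LinearMap.add_apply, LinearMap.smul_apply, AlgHom.toLinearMap_apply, coeff_add,
    coeff_smul]
  rw [cT0 _ (by simp) (by simp) (by intro j; simp), cT1 _ (by simp) (by simp) (by intro j; simp),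
    cT2 _ (by simp) (by simp) (by intro j; simp), cT3 _ (by simp) (by simp) (by intro j; simp)]
  simp only [smul_eq_mul]
  ring

end

lemma multisetOf_cons {m : ℕ} (a : ℕ) (v : Fin m → ℕ) :
    multisetOf (Fin.cons a v : Fin (m + 1) → ℕ) = a ::ₘ multisetOf v := by
  simp [multisetOf, Fin.univ_val_map, List.ofFn_cons]

lemma multisetOf_card {m : ℕ} (v : Fin m → ℕ) : Multiset.card (multisetOf v) = m := by
  simp [multisetOf]

lemma multisetOf_sum {m : ℕ} (v : Fin m → ℕ) : (multisetOf v).sum = ∑ i, v i := rfl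

lemma exMult_fs {m : ℕ} (v : Fin m → ℕ) : exMult (fs v) = multisetOf v := by
  simp [exMult, fs]

lemma exMult_f2 {K : ℕ} (a b : ℕ) (v : Fin K → ℕ) : exMult (f2 a b v) = a ::ₘ b ::ₘ multisetOf v := by
  rw [f2, exMult_fs, multisetOf_cons, multisetOf_cons]

lemma multisetOf_surj {m : ℕ} {s : Multiset ℕ} (h : Multiset.card s = m) :
    ∃ v : Fin m → ℕ, multisetOf v = s := by
  have key : ∀ l : List ℕ, multisetOf (fun i : Fin l.length => l.get i) = (l : Multiset ℕ) := by
    intro l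
    rw [multisetOf, Fin.univ_val_map, List.ofFn_get]
  obtain ⟨l, rfl⟩ : ∃ l : List ℕ, s = (l : Multiset ℕ) := ⟨s.toList, by simp⟩
  rw [Multiset.coe_card] at h
  subst h
  exact ⟨_, key l⟩

lemma exMult_surj {m : ℕ} {s : Multiset ℕ} (h : Multiset.card s = m) :
    ∃ d : Fin m →₀ ℕ, exMult d = s := by
  obtain ⟨v, hv⟩ := multisetOf_surj h
  exact ⟨fs v, by rw [exMult_fs, hv]⟩

lemma multisetOf_comp {m : ℕ} (v : Fin m → ℕ) (σ : Equiv.Perm (Fin m)) :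
    multisetOf (v ∘ σ) = multisetOf v := by
  unfold multisetOf
  rw [← Multiset.map_map, Multiset.map_univ_val_equiv]

lemma exists_perm {m : ℕ} {v w : Fin m → ℕ} (h : multisetOf v = multisetOf w) :
    ∃ σ : Equiv.Perm (Fin m), v ∘ σ = w := by
  have h1 : multisetOf (v ∘ Tuple.sort v) = multisetOf (w ∘ Tuple.sort w) := by
    rw [multisetOf_comp, multisetOf_comp, h]
  unfold multisetOf at h1
  rw [Fin.univ_val_map, Fin.univ_val_map, Multiset.coe_eq_coe] at h1
  have h2 := List.Perm.eq_of_sortedLE (Monotone.sortedLE_ofFn (Tuple.monotone_sort v))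
    (Monotone.sortedLE_ofFn (Tuple.monotone_sort w)) h1
  have h3 := List.ofFn_injective h2
  refine ⟨(Tuple.sort w).symm.trans (Tuple.sort v), ?_⟩
  funext i
  have := congrFun h3 ((Tuple.sort w).symm i)
  simpa using this

lemma sym_iff {A : Type*} [CommRing A] {m : ℕ} (f : MvPolynomial (Fin m) A) :
    f.IsSymmetric ↔ ∀ d d', exMult d = exMult d' → coeff d f = coeff d' f := by
  have hmap : ∀ (e : Equiv.Perm (Fin m)) (d : Fin m →₀ ℕ), ⇑(Finsupp.mapDomain e d) = d ∘ e.symm := by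
    intro e d
    funext i
    simp [Finsupp.mapDomain_equiv_apply]
  constructor
  · intro h d d' hd
    obtain ⟨σ, hσ⟩ := exists_perm hd
    have := coeff_rename_mapDomain σ.symm σ.symm.injective f d
    rw [h σ.symm] at this
    rw [← this]
    congr 1
    ext i
    rw [hmap, ← hσ]
    rfl
  · intro h e
    ext d
    have e1 : d = Finsupp.mapDomain e (Finsupp.mapDomain e.symm d) := by
      ext i
      simp [hmap]
    rw [e1, coeff_rename_mapDomain e e.injective]
    apply h
    rw [← e1]
    unfold exMult
    rw [hmap]
    exact multisetOf_comp _ _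

/-- cocycle equation -/
def Coc (p K : ℕ) (C : Multiset ℕ → ZMod p) : Prop := ∀ a b c u, Multiset.card u = K →
  (if a = 0 then C (b ::ₘ c ::ₘ u) else 0)
      - ((a + b).choose a : ZMod p) * C ((a + b) ::ₘ c ::ₘ u)
      + ((b + c).choose b : ZMod p) * C (a ::ₘ (b + c) ::ₘ u)
      - (if c = 0 then C (a ::ₘ b ::ₘ u) else 0) = 0

lemma delta_iff {p K : ℕ} {f : MvPolynomial (Fin (K + 2)) (ZMod p)} {C : Multiset ℕ → ZMod p}
    (h : ∀ d, coeff d f = C (exMult d)) : deltaLM (ZMod p) 2 (K + 2) f = 0 ↔ Coc p K C := by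
  constructor
  · intro h0 a b c u hu
    obtain ⟨v, rfl⟩ := multisetOf_surj hu
    have := coeff_delta f a b c v
    rw [h0, coeff_zero] at this
    simp only [h, exMult_f2] at this
    exact this.symm
  · intro hC
    ext d
    obtain ⟨a, b, c, v, rfl⟩ := f3_surj d
    rw [coeff_delta]
    simp only [h, exMult_f2, coeff_zero]
    exact hC a b c _ (multisetOf_card v)

noncomputable def W (p : ℕ) (s : Multiset ℕ) : ZMod p := (s.map (ww p)).prod

lemma W_cons (p x : ℕ) (s : Multiset ℕ) : W p (x ::ₘ s) = ww p x * W p s := by simp [W]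

lemma W_ne {p : ℕ} (hp : p.Prime) (s : Multiset ℕ) : W p s ≠ 0 := by
  have := Fact.mk hp
  induction s using Multiset.induction_on with
  | empty => simp [W]
  | cons x s ih => rw [W_cons]; exact mul_ne_zero (ww_ne hp x) ih

open Classical in
lemma key_id {p : ℕ} (hp : p.Prime) (C : Multiset ℕ → ZMod p) (a b c : ℕ) (u : Multiset ℕ) :
    (if nc p a b then C ((a + b) ::ₘ c ::ₘ u) * W p ((a + b) ::ₘ c ::ₘ u) else 0)
      - (if nc p b c then C (a ::ₘ (b + c) ::ₘ u) * W p (a ::ₘ (b + c) ::ₘ u) else 0) =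
    (((a + b).choose a : ZMod p) * C ((a + b) ::ₘ c ::ₘ u)
      - ((b + c).choose b : ZMod p) * C (a ::ₘ (b + c) ::ₘ u)) *
      (ww p a * ww p b * ww p c * W p u) := by
  have h1 := ww_choose hp a b
  have h2 := ww_choose hp b c
  have e1 : (if nc p a b then C ((a + b) ::ₘ c ::ₘ u) * W p ((a + b) ::ₘ c ::ₘ u) else 0) =
      (if nc p a b then ww p (a + b) else 0) * (C ((a + b) ::ₘ c ::ₘ u) * ww p c * W p u) := by
    rw [W_cons, W_cons]; split_ifs <;> ring
  have e2 : (if nc p b c then C (a ::ₘ (b + c) ::ₘ u) * W p (a ::ₘ (b + c) ::ₘ u) else 0) =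
      (if nc p b c then ww p (b + c) else 0) * (C (a ::ₘ (b + c) ::ₘ u) * ww p a * W p u) := by
    rw [W_cons, W_cons]; split_ifs <;> ring
  rw [e1, e2, ← h1, ← h2]
  ring

lemma rel_of_coc {p K : ℕ} (hp : p.Prime) {C : Multiset ℕ → ZMod p} (h : Coc p K C) :
    Rel p K (fun s => C s * W p s) := by
  intro a b c u ha hb hc hu hK
  rw [← sub_eq_zero]
  have h1 := h a b c u hK
  rw [if_neg (by omega), if_neg (by omega)] at h1
  have h2 := key_id hp C a b c u
  rw [h2]
  linear_combination (-(ww p a * ww p b * ww p c * W p u)) * h1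

lemma coc_of_rel {p K : ℕ} (hp : p.Prime) {C C' : Multiset ℕ → ZMod p} (h : Rel p K C')
    (h0 : ∀ s, 0 ∈ s → C s = 0)
    (hCC : ∀ s, (∀ x ∈ s, 0 < x) → Multiset.card s = K + 2 → C s * W p s = C' s) :
    Coc p K C := by
  have := Fact.mk hp
  intro a b c u hK
  by_cases hb : b = 0
  · subst hb
    have e1 : (if a = 0 then C (0 ::ₘ c ::ₘ u) else 0) = 0 := by
      split_ifs
      · exact h0 _ (by simp)
      · rfl
    have e2 : (if c = 0 then C (a ::ₘ 0 ::ₘ u) else 0) = 0 := by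
      split_ifs
      · exact h0 _ (by simp)
      · rfl
    rw [e1, e2]; simp
  by_cases ha : a = 0
  · subst ha
    have e2 : (if c = 0 then C (0 ::ₘ b ::ₘ u) else 0) = 0 := by
      split_ifs
      · exact h0 _ (by simp)
      · rfl
    rw [e2, h0 (0 ::ₘ (b + c) ::ₘ u) (by simp)]; simp
  by_cases hc : c = 0
  · subst hc
    rw [if_neg ha, h0 ((a + b) ::ₘ 0 ::ₘ u) (by simp)]; simp
  rw [if_neg ha, if_neg hc]
  by_cases hu : 0 ∈ u
  · rw [h0 ((a + b) ::ₘ c ::ₘ u) (by simp [hu]), h0 (a ::ₘ (b + c) ::ₘ u) (by simp [hu])]; simp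
  have hu' : ∀ x ∈ u, 0 < x := fun x hx => Nat.pos_of_ne_zero (fun h => hu (h ▸ hx))
  have h1 := h a b c u (by omega) (by omega) (by omega) hu' hK
  have h2 := key_id hp C a b c u
  rw [hCC ((a + b) ::ₘ c ::ₘ u), hCC (a ::ₘ (b + c) ::ₘ u), h1, sub_self] at h2
  · have h3 : ww p a * ww p b * ww p c * W p u ≠ 0 := by
      refine mul_ne_zero (mul_ne_zero (mul_ne_zero ?_ ?_) ?_) (W_ne hp u) <;> exact ww_ne hp _
    rcases mul_eq_zero.1 h2.symm with h4 | h4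
    · linear_combination -h4
    · exact absurd h4 h3
  · intro x hx
    simp only [Multiset.mem_cons] at hx
    rcases hx with rfl | rfl | hx
    exacts [by omega, by omega, hu' x hx]
  · simp [hK]
  · intro x hx
    simp only [Multiset.mem_cons] at hx
    rcases hx with rfl | rfl | hx
    exacts [by omega, by omega, hu' x hx]
  · simp [hK]

lemma zero_of_coc {p K n : ℕ} (hn : 0 < n) {C : Multiset ℕ → ZMod p} (h : Coc p K C)
    (hs : ∀ s, s.sum ≠ n → C s = 0) (s : Multiset ℕ) (h0 : 0 ∈ s) (hc : Multiset.card s = K + 2) :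
    C s = 0 := by
  by_contra hne
  have hsum : s.sum = n := by
    by_contra h1; exact hne (hs s h1)
  obtain ⟨t, rfl⟩ := Multiset.exists_cons_of_mem h0
  have : ∃ c ∈ t, c ≠ 0 := by
    by_contra hcon
    push Not at hcon
    have := Multiset.sum_eq_zero hcon
    simp at hsum
    omega
  obtain ⟨c, hct, hc0⟩ := this
  obtain ⟨u, rfl⟩ := Multiset.exists_cons_of_mem hct
  have := h 0 0 c u (by simpa using hc)
  simp [hc0] at this
  exact hne this

lemma rel_of_G {p n K k' : ℕ} (hp : p.Prime) (hmin : MinK p n (K + 2) k')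
    {G : Multiset ℕ → ZMod p}
    (hG : ∀ N, ¬ (IsPowOf p N ∧ Multiset.card N = k' ∧ N.sum = n) → G N = 0) :
    Rel p K (fun s => G (Db p s)) := by
  intro a b c u ha hb hc hu hK
  have hap := DD_card_pos (p := p) ha
  have hcp := DD_card_pos (p := p) hc
  have hup := Db_card p hu
  -- auxiliary: good implies no carry
  have aux : ∀ x y z, 0 < Multiset.card (DD p z) → G (DD p x + DD p y + (DD p z + Db p u)) ≠ 0 →
      nc p x y := by
    intro x y z hz hne
    by_contra hcon
    apply hne
    apply hG
    rintro ⟨h1, h2, h3⟩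
    have := good_red hp hmin h1 h2 h3 (by rw [Multiset.card_add]; omega)
    rw [Multiset.sum_add, DD_sum, DD_sum] at this
    exact hcon this.symm
  simp only [Db_cons]
  split_ifs with h1 h2 h2
  · rw [h1, h2]
    congr 1; abel
  · by_contra hne
    apply h2
    apply aux b c a hap
    rw [h1] at hne
    convert! hne using 2
    abel
  · by_contra hne
    apply h1
    apply aux a b c hcp
    rw [h2] at hne
    intro h
    apply hne
    rw [← h]
    congr 1; abel
  · rfl

noncomputable def CC {p m : ℕ} (f : MvPolynomial (Fin m) (ZMod p)) (s : Multiset ℕ) : ZMod p :=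
  open Classical in if h : ∃ d : Fin m →₀ ℕ, exMult d = s then coeff h.choose f else 0

lemma CC_spec {p m : ℕ} {f : MvPolynomial (Fin m) (ZMod p)} (hf : f.IsSymmetric) (d : Fin m →₀ ℕ) :
    coeff d f = CC f (exMult d) := by
  have h : ∃ d' : Fin m →₀ ℕ, exMult d' = exMult d := ⟨d, rfl⟩
  rw [CC, dif_pos h]
  exact (sym_iff f).1 hf _ _ h.choose_spec.symm

lemma exMult_sum {m : ℕ} (d : Fin m →₀ ℕ) : (exMult d).sum = d.degree := by
  rw [Finsupp.degree_eq_sum]; rfl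

lemma CC_hom {p m n : ℕ} {f : MvPolynomial (Fin m) (ZMod p)} (hf : f.IsHomogeneous n)
    (s : Multiset ℕ) (hs : s.sum ≠ n) : CC f s = 0 := by
  rw [CC]
  split_ifs with h
  · apply hf.coeff_eq_zero
    rw [← exMult_sum, h.choose_spec]; exact hs
  · rfl

noncomputable def PP {p : ℕ} (m n : ℕ) (C : Multiset ℕ → ZMod p) : MvPolynomial (Fin m) (ZMod p) :=
  ∑ d ∈ Finset.finsuppAntidiag Finset.univ n, monomial d (C (exMult d))

lemma PP_coeff {p m n : ℕ} {C : Multiset ℕ → ZMod p} (hC : ∀ s, s.sum ≠ n → C s = 0)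
    (d : Fin m →₀ ℕ) : coeff d (PP m n C) = C (exMult d) := by
  rw [PP, coeff_sum]
  simp only [coeff_monomial]
  rw [Finset.sum_ite_eq']
  split_ifs with h
  · rfl
  · rw [hC]
    intro h'
    apply h
    simp [Finset.mem_finsuppAntidiag]
    exact h'

lemma PP_hom {p m n : ℕ} {C : Multiset ℕ → ZMod p} : (PP m n C).IsHomogeneous n := by
  apply IsHomogeneous.sum
  intro d hd
  apply isHomogeneous_monomial
  rw [Finsupp.degree_eq_sum]
  exact (Finset.mem_finsuppAntidiag.1 hd).1

noncomputable abbrev VV (p n K : ℕ) : Submodule (ZMod p) (MvPolynomial (Fin (K + 2)) (ZMod p)) :=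
  LinearMap.ker (deltaLM (ZMod p) 2 (K + 2)) ⊓
            MvPolynomial.homogeneousSubmodule (Fin (K + 2)) (ZMod p) n ⊓
            Subalgebra.toSubmodule (MvPolynomial.symmetricSubalgebra (Fin (K + 2)) (ZMod p))

lemma mem_VV {p n K : ℕ} (f : MvPolynomial (Fin (K + 2)) (ZMod p)) : f ∈ VV p n K ↔
    deltaLM (ZMod p) 2 (K + 2) f = 0 ∧ f.IsHomogeneous n ∧ f.IsSymmetric := by
  rw [Submodule.mem_inf, Submodule.mem_inf, LinearMap.mem_ker, mem_homogeneousSubmodule,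
    Subalgebra.mem_toSubmodule, mem_symmetricSubalgebra, and_assoc]

lemma dim {p n K k' : ℕ} (hp : p.Prime) (hn : 0 < n) (hmin : MinK p n (K + 2) k')
    (hex : ∃ μ : Multiset ℕ, IsPowOf p μ ∧ Multiset.card μ = k' ∧ μ.sum = n) (hkk : K + 2 ≤ k') :
    Module.finrank (ZMod p) (VV p n K) =
      Set.ncard {μ : Multiset ℕ | IsPowOf p μ ∧ Multiset.card μ = k' ∧ μ.sum = n} := by
  classical
  have := Fact.mk hp
  set S := {μ : Multiset ℕ | IsPowOf p μ ∧ Multiset.card μ = k' ∧ μ.sum = n} with hS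
  have hrep : ∀ N : S, ∃ m Q, ∃ d : Fin (K + 2) →₀ ℕ, 0 < m ∧ IsPowOf p Q ∧
      Multiset.card Q = K + 1 ∧ DD p m + Q = N ∧ exMult d = m ::ₘ Q := by
    rintro ⟨N, h1, h2, h3⟩
    obtain ⟨m, Q, hm, hQ, hQc, hD⟩ := exists_rep hp hmin hkk h1 h2 h3
    obtain ⟨d, hd⟩ := exMult_surj (m := K + 2) (s := m ::ₘ Q) (by simp [hQc])
    exact ⟨m, Q, d, hm, hQ, hQc, hD, hd⟩
  choose m Q d hm hQ hQc hD hd using hrep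
  have hfin : Finite S := by
    let φ : S → Nat.Partition n := fun N =>
      ⟨N.1, fun {i} hi => pow_pos_mem hp N.2.1 hi, N.2.2.2⟩
    apply Finite.of_injective φ
    intro N M h
    apply Subtype.ext
    exact congrArg Nat.Partition.parts h
  have : Fintype S := Fintype.ofFinite S
  let Φ : VV p n K →ₗ[ZMod p] (S → ZMod p) :=
    { toFun := fun f N => coeff (d N) f.1
      map_add' := by intro f g; funext N; simp
      map_smul' := by intro r f; funext N; simp }
  have hinj : Function.Injective Φ := by
    rw [← LinearMap.ker_eq_bot, LinearMap.ker_eq_bot']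
    rintro ⟨f, hf⟩ h
    obtain ⟨h1, h2, h3⟩ := (mem_VV f).1 hf
    have hcoc := (delta_iff (CC_spec h3)).1 h1
    have hrel := rel_of_coc hp hcoc
    apply Subtype.ext
    change f = 0
    ext e
    rw [CC_spec h3, coeff_zero]
    by_cases hsum : (exMult e).sum = n
    · by_cases h0 : 0 ∈ exMult e
      · exact zero_of_coc hn hcoc (CC_hom h2) _ h0 (multisetOf_card _)
      · have := vanish hp hmin hex hkk hrel (by
          intro N a b c
          refine ⟨m ⟨N, a, b, c⟩, Q ⟨N, a, b, c⟩, hQ _, hQc _, hD _, ?_⟩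
          have hz := congrFun h ⟨N, a, b, c⟩
          change coeff (d ⟨N, a, b, c⟩) f = 0 at hz
          rw [CC_spec h3, hd] at hz
          simp only [hz, zero_mul]) (exMult e)
          (fun x hx => Nat.pos_of_ne_zero (fun h => h0 (h ▸ hx))) (multisetOf_card _) hsum
        exact (mul_eq_zero.1 this).resolve_right (W_ne hp _)
    · exact CC_hom h2 _ hsum
  have hsurj : Function.Surjective Φ := by
    intro g
    let G : Multiset ℕ → ZMod p := fun N =>
      if h : N ∈ S then g ⟨N, h⟩ * W p (exMult (d ⟨N, h⟩)) else 0
    have hG : ∀ N, ¬ (IsPowOf p N ∧ Multiset.card N = k' ∧ N.sum = n) → G N = 0 := by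
      intro N h
      exact dif_neg h
    let C : Multiset ℕ → ZMod p := fun s =>
      if Multiset.card s = K + 2 ∧ (∀ x ∈ s, 0 < x) then G (Db p s) / W p s else 0
    have hC0 : ∀ s, 0 ∈ s → C s = 0 := by
      intro s h
      apply if_neg
      rintro ⟨-, h2⟩
      exact lt_irrefl _ (h2 0 h)
    have hCs : ∀ s, s.sum ≠ n → C s = 0 := by
      intro s h
      have : G (Db p s) = 0 := hG _ (by rw [Db_sum]; tauto)
      simp only [C, this, zero_div, ite_self]
    have hCp : ∀ s, (∀ x ∈ s, 0 < x) → Multiset.card s = K + 2 → C s * W p s = G (Db p s) := by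
      intro s h1 h2
      simp only [C]
      rw [if_pos ⟨h2, h1⟩, div_mul_cancel₀ _ (W_ne hp s)]
    have hcoc : Coc p K C := coc_of_rel hp (rel_of_G hp hmin hG) hC0 hCp
    have hco := PP_coeff (m := K + 2) hCs
    refine ⟨⟨PP (K + 2) n C, (mem_VV _).2 ⟨(delta_iff hco).2 hcoc, PP_hom, ?_⟩⟩, ?_⟩
    · rw [sym_iff]
      intro e e' h
      rw [hco, hco, h]
    · funext N
      change coeff (d N) (PP (K + 2) n C) = g N
      rw [hco]
      have hDb : Db p (exMult (d N)) = N := by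
        rw [hd, Db_cons, Db_of_pow hp (hQ N), hD]
      have h1 := hCp (exMult (d N)) (by
        rw [hd]
        intro x hx
        rcases Multiset.mem_cons.1 hx with rfl | hx
        exacts [hm N, pow_pos_mem hp (hQ N) hx]) (multisetOf_card _)
      rw [hDb] at h1
      have h2 : G N = g N * W p (exMult (d N)) := dif_pos N.2
      rw [h2] at h1
      exact mul_right_cancel₀ (W_ne hp _) h1
  rw [(LinearEquiv.ofBijective Φ ⟨hinj, hsurj⟩).finrank_eq, Module.finrank_fintype_fun_eq_card,
    ← Nat.card_eq_fintype_card]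
  rfl

end S17

/-- For `n ≥ k ≥ 2`, there is a least `k' ≥ k` (and `k' ≤ n`)
for which a power-of-`p` multiset of cardinality `k'` and sum `n` exists, and the
dimension over `ℤ/pℤ` of the space of symmetric homogeneous degree-`n`
`2`-cocycles in `k` variables equals the number of power-of-`p` multisets of
cardinality `k'` with sum `n`. -/
theorem statement17 (p : ℕ) (hp : p.Prime) (n k : ℕ) (hk : 2 ≤ k) (hkn : k ≤ n) :
    ∃ k' : ℕ, k ≤ k' ∧ k' ≤ n ∧
      (∃ μ : Multiset ℕ, IsPowOf p μ ∧ Multiset.card μ = k' ∧ μ.sum = n) ∧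
      (∀ j : ℕ, k ≤ j →
        (∃ μ : Multiset ℕ, IsPowOf p μ ∧ Multiset.card μ = j ∧ μ.sum = n) → k' ≤ j) ∧
      Module.finrank (ZMod p)
        ↥(LinearMap.ker (deltaLM (ZMod p) 2 k) ⊓
            MvPolynomial.homogeneousSubmodule (Fin k) (ZMod p) n ⊓
            Subalgebra.toSubmodule (MvPolynomial.symmetricSubalgebra (Fin k) (ZMod p)))
        = Set.ncard {μ : Multiset ℕ | IsPowOf p μ ∧ Multiset.card μ = k' ∧ μ.sum = n} := by
  classical
  have hE : ∃ j, k ≤ j ∧ ∃ μ : Multiset ℕ, IsPowOf p μ ∧ Multiset.card μ = j ∧ μ.sum = n :=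
    ⟨n, hkn, Multiset.replicate n 1, fun x hx => ⟨0, by simpa using Multiset.eq_of_mem_replicate hx⟩,
      by simp, by simp⟩
  have hmin : ∀ j : ℕ, k ≤ j →
      (∃ μ : Multiset ℕ, IsPowOf p μ ∧ Multiset.card μ = j ∧ μ.sum = n) → Nat.find hE ≤ j :=
    fun j h1 h2 => Nat.find_min' hE ⟨h1, h2⟩
  refine ⟨Nat.find hE, (Nat.find_spec hE).1, ?_, (Nat.find_spec hE).2, hmin, ?_⟩
  · exact hmin n hkn ⟨Multiset.replicate n 1,
      fun x hx => ⟨0, by simpa using Multiset.eq_of_mem_replicate hx⟩, by simp, by simp⟩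
  · have h1 := (Nat.find_spec hE).1
    have h2 := (Nat.find_spec hE).2
    generalize Nat.find hE = k' at *
    obtain ⟨K, rfl⟩ := Nat.exists_eq_add_of_le' hk
    exact S17.dim hp (by omega) hmin h2 h1
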